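/- Let γ ∈ ℝ with γ ≠ 0 and |γ| ≠ 1, and let s ≥ 1/2. Then there exists a constant C > 0 (depending on γ and s) such that for all nonnegative functions f, g, h ∈ L²(ℝ×ℤ): Σ_{n,n₁∈ℤ} ∫_{ℝ²} [ |n| ⟨n⟩^{s−1/2} h(τ,n) f(τ₁,n₁) g(τ−τ₁, n−n₁) ] / [ ⟨τ+γ|n|n⟩^{3/8} ⟨n₁⟩^{s} ⟨τ₁+n₁²⟩^{1/2} ⟨n−n₁⟩^{s} ⟨τ−τ₁−(n−n₁)²⟩^{1/2} ] dτ dτ₁ ≤ C ‖f‖_{L²(ℝ×ℤ)} ‖g‖_{L²(ℝ×ℤ)} ‖h‖_{L²(ℝ×ℤ)}. (This is the dual formulation of the periodic bilinear estimate ‖∂ₓ(u v̄)‖_{Y_{γ,per}^{s−1/2,−3/8}} ≲ ‖u‖_{X_{per}^{s,1/2}} ‖v‖_{X_{per}^{s,1/2}}.) -/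

import Mathlib

open MeasureTheory ENNReal

/-- Japanese bracket `⟨x⟩ = 1 + |x|`. -/
noncomputable def jb (x : ℝ) : ℝ := 1 + |x|

/-- The `L²(ℝ×ℤ)` norm (valued in `ℝ≥0∞`) of a nonnegative function,
with respect to the product of Lebesgue measure on `ℝ` and counting measure on `ℤ`. -/
noncomputable def l2RZ (f : ℝ × ℤ → ℝ) : ℝ≥0∞ :=
  (∑' n : ℤ, ∫⁻ τ : ℝ, ENNReal.ofReal (f (τ, n)) ^ 2) ^ (1/2 : ℝ)


lemma jb_one_le (x : ℝ) : 1 ≤ jb x := by unfold jb; linarith [abs_nonneg x]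
lemma jb_pos (x : ℝ) : 0 < jb x := lt_of_lt_of_le one_pos (jb_one_le x)
lemma jb_neg (x : ℝ) : jb (-x) = jb x := by simp [jb]
lemma jb_sub_le (x y : ℝ) : jb (x - y) ≤ jb x * jb y := by
  unfold jb
  nlinarith [abs_sub x y, mul_nonneg (abs_nonneg x) (abs_nonneg y)]
lemma jb_add_le (x y : ℝ) : jb (x + y) ≤ jb x * jb y := by
  have := jb_sub_le x (-y)
  rwa [sub_neg_eq_add, jb_neg] at this
lemma measurable_jb : Measurable jb := by unfold jb; fun_prop

/-- The reference product measure. -/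
noncomputable def muE : Measure (ℝ × ℤ) := (volume : Measure ℝ).prod (Measure.count : Measure ℤ)

instance : SFinite muE := by unfold muE; infer_instance
instance : muE.IsAddLeftInvariant := by unfold muE; infer_instance
instance : muE.IsAddRightInvariant := by unfold muE; infer_instance
instance : muE.IsNegInvariant := by
  constructor
  unfold muE
  have h := Measure.map_prod_map (volume : Measure ℝ) (Measure.count : Measure ℤ)
    (f := fun x : ℝ => -x) (g := fun n : ℤ => -n) measurable_neg measurable_neg
  have h1 : Measure.map (fun x : ℝ => -x) volume = volume := Measure.map_neg_eq_self volume
  have h2 : Measure.map (fun n : ℤ => -n) Measure.count = Measure.count :=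
    Measure.map_neg_eq_self Measure.count
  rw [h1, h2] at h
  exact h.symm

lemma lintegral_muE (F : ℝ × ℤ → ℝ≥0∞) (hF : Measurable F) :
    ∫⁻ x, F x ∂muE = ∑' n : ℤ, ∫⁻ τ : ℝ, F (τ, n) := by
  unfold muE
  rw [lintegral_prod_symm' _ hF, lintegral_count]

lemma sum_bound : ∃ S : ℝ≥0∞, S ≠ ⊤ ∧ ∀ y : ℝ,
    ∑' n : ℤ, ENNReal.ofReal (jb ((n : ℝ) - y) ^ (-(9/8) : ℝ)) ≤ S := by
  have hs : Summable (fun n : ℤ => jb (n : ℝ) ^ (-(9/8) : ℝ)) := by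
    have h1 : Summable (fun n : ℤ => |(n : ℝ)| ^ (-(9/8) : ℝ)) :=
      Real.summable_abs_int_rpow (by norm_num)
    refine Summable.of_norm_bounded_eventually h1 ?_
    have : {n : ℤ | ¬ ‖jb (n : ℝ) ^ (-(9/8) : ℝ)‖ ≤ |(n : ℝ)| ^ (-(9/8) : ℝ)} ⊆ {0} := by
      intro n hn
      by_contra h0
      apply hn
      have hn0 : 0 < |(n : ℝ)| := by
        rw [abs_pos]; exact_mod_cast h0
      rw [Real.norm_of_nonneg (Real.rpow_nonneg (jb_pos _).le _)]
      exact Real.rpow_le_rpow_of_nonpos hn0 (by unfold jb; linarith) (by norm_num)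
    exact (Set.finite_singleton _).subset this
  refine ⟨ENNReal.ofReal (2 ^ (9/8 : ℝ)) * ∑' n : ℤ, ENNReal.ofReal (jb (n : ℝ) ^ (-(9/8) : ℝ)), ?_, ?_⟩
  · exact ENNReal.mul_ne_top ENNReal.ofReal_ne_top hs.tsum_ofReal_ne_top
  · intro y
    rw [← (Equiv.subRight (⌊y⌋ : ℤ)).tsum_eq (fun n : ℤ => ENNReal.ofReal (jb (n : ℝ) ^ (-(9/8) : ℝ))), ← ENNReal.tsum_mul_left]
    refine ENNReal.tsum_le_tsum fun n => ?_
    rw [← ENNReal.ofReal_mul (by positivity)]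
    refine ENNReal.ofReal_le_ofReal ?_
    have hx := jb_pos ((n : ℝ) - y)
    have hle : jb (((n - ⌊y⌋ : ℤ)) : ℝ) ≤ 2 * jb ((n : ℝ) - y) := by
      unfold jb
      push_cast
      have h1 := Int.floor_le y
      have h2 := Int.lt_floor_add_one y
      have : |(n : ℝ) - ⌊y⌋| ≤ |(n : ℝ) - y| + |y - ⌊y⌋| := by
        have := abs_add_le ((n : ℝ) - y) (y - ⌊y⌋)
        rwa [sub_add_sub_cancel] at this
      have h3 : |y - ⌊y⌋| ≤ 1 := by rw [abs_le]; constructor <;> linarith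
      linarith [abs_nonneg ((n:ℝ) - y)]
    have h4 := Real.rpow_le_rpow_of_nonpos (jb_pos _) hle (show (-(9/8):ℝ) ≤ 0 by norm_num)
    rw [Real.mul_rpow (by norm_num) hx.le] at h4
    have h5 : (2:ℝ) ^ (9/8:ℝ) * (2:ℝ) ^ (-(9/8):ℝ) = 1 := by
      rw [← Real.rpow_add (by norm_num)]; norm_num
    calc jb ((n:ℝ) - y) ^ (-(9/8):ℝ) = 2 ^ (9/8:ℝ) * (2 ^ (-(9/8):ℝ) * jb ((n:ℝ) - y) ^ (-(9/8):ℝ)) := by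
          rw [← mul_assoc, h5, one_mul]
      _ ≤ _ := by
        simp only [Equiv.subRight_apply]
        gcongr

lemma int_bound : ∃ I : ℝ≥0∞, I ≠ ⊤ ∧
    ∫⁻ τ : ℝ, ENNReal.ofReal (jb τ ^ (-(9/8) : ℝ)) = I := by
  refine ⟨_, ?_, rfl⟩
  have := integrable_one_add_norm (E := ℝ) (μ := volume) (r := 9/8) (by norm_num)
  have h2 := this.lintegral_lt_top
  exact h2.ne

lemma key_ineq (u v : ℝ) : jb u ^ (-(3/4) : ℝ) * jb v ^ (-1 : ℝ) ≤
    2 * jb (u - v) ^ (-(5/8) : ℝ) * (jb u ^ (-(9/8) : ℝ) + jb v ^ (-(9/8) : ℝ)) := by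
  have main : ∀ M m D p r : ℝ, 1 ≤ m → m ≤ M → 0 < D → D ≤ 2 * M → 5/8 ≤ p → p + r = 7/4 →
      M ^ (-p) * m ^ (-r) ≤ 2 * D ^ (-(5/8) : ℝ) * m ^ (-(9/8) : ℝ) := by
    intro M m D p r hm hmM hD hDM hp hpr
    have hm0 : 0 < m := by linarith
    have hM0 : 0 < M := by linarith
    have e1 : M ^ (-p) = M ^ (-(5/8) : ℝ) * M ^ (-(p - 5/8)) := by
      rw [← Real.rpow_add hM0]; ring_nf
    have e2 : m ^ (-(9/8) : ℝ) = m ^ (-(p - 5/8)) * m ^ (-r) := by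
      rw [← Real.rpow_add hm0]; congr 1; linarith
    have h1 : M ^ (-(p - 5/8)) ≤ m ^ (-(p - 5/8)) :=
      Real.rpow_le_rpow_of_nonpos hm0 hmM (by linarith)
    have h2 : M ^ (-(5/8) : ℝ) ≤ 2 * D ^ (-(5/8) : ℝ) := by
      have h3 := Real.rpow_le_rpow_of_nonpos (z := (-(5/8) : ℝ)) hD hDM (by norm_num)
      rw [Real.mul_rpow (by norm_num) hM0.le] at h3
      have h4 : (1/2 : ℝ) ≤ 2 ^ (-(5/8) : ℝ) := by
        have : (2:ℝ) ^ (-1 : ℝ) ≤ 2 ^ (-(5/8) : ℝ) :=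
          Real.rpow_le_rpow_of_exponent_le (by norm_num) (by norm_num)
        rw [Real.rpow_neg_one] at this
        linarith
      have h5 : 0 < M ^ (-(5/8) : ℝ) := Real.rpow_pos_of_pos hM0 _
      nlinarith
    rw [e1, e2]
    have := Real.rpow_pos_of_pos hm0 (-r)
    have := Real.rpow_pos_of_pos hM0 (-(p - 5/8))
    have := Real.rpow_pos_of_pos hD (-(5/8))
    calc _ ≤ (2 * D ^ (-(5/8) : ℝ)) * m ^ (-(p - 5/8)) * m ^ (-r) := by gcongr
      _ = _ := by ring
  have hu := jb_one_le u
  have hv := jb_one_le v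
  have hD := jb_pos (u - v)
  have hDle : jb (u - v) ≤ jb u + jb v := by
    unfold jb; linarith [abs_sub u v]
  have p1 := Real.rpow_pos_of_pos hD (-(5/8))
  have p2 := Real.rpow_pos_of_pos (jb_pos u) (-(9/8))
  have p3 := Real.rpow_pos_of_pos (jb_pos v) (-(9/8))
  rcases le_total (jb u) (jb v) with h | h
  · have := main (jb v) (jb u) (jb (u - v)) 1 (3/4) hu h hD (by linarith) (by norm_num) (by norm_num)
    rw [mul_comm (jb u ^ _)]
    refine this.trans ?_
    rw [mul_add]
    have := mul_pos (mul_pos two_pos p1) p3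
    linarith
  · have := main (jb u) (jb v) (jb (u - v)) (3/4) 1 hv h hD (by linarith) (by norm_num) (by norm_num)
    refine this.trans ?_
    rw [mul_add]
    have := mul_pos (mul_pos two_pos p1) p2
    linarith

lemma quad_bound (γ : ℝ) (hγ1 : |γ| ≠ 1) : ∃ S : ℝ≥0∞, S ≠ ⊤ ∧ ∀ B m : ℝ,
    ∑' n : ℤ, ENNReal.ofReal (jb (B + n * (γ * |(n : ℝ)| + n - 2 * m)) ^ (-(5/8) : ℝ)) ≤ S := by
  obtain ⟨S, hS, hsum⟩ := sum_bound
  -- one-sided version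
  have one : ∀ l : ℝ, l ≠ 0 → ∃ T : ℝ≥0∞, T ≠ ⊤ ∧ ∀ B m : ℝ,
      ∑' n : ℤ, ENNReal.ofReal (jb (B + n * (l * n - 2 * m)) ^ (-(5/8) : ℝ)) ≤ T := by
    intro l hl
    have hl' : 0 < |l| := abs_pos.mpr hl
    set c : ℝ := min 1 |l| / 2 with hc
    have hc0 : 0 < c := by positivity
    have hc1 : c ≤ 1/2 := by
      have := min_le_left 1 |l|
      rw [hc]; linarith
    have hcl : 2 * c ≤ |l| := by
      have := min_le_right 1 |l|
      rw [hc]; linarith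
    refine ⟨ENNReal.ofReal (c ^ (-(5/8) : ℝ)) * (S + S),
      ENNReal.mul_ne_top ENNReal.ofReal_ne_top (by simp [hS]), ?_⟩
    intro B m
    -- two centers
    obtain ⟨y₁, y₂, hy⟩ : ∃ y₁ y₂ : ℝ, ∀ n : ℝ,
        |l| * (n - y₁) ^ 2 ≤ |B + n * (l * n - 2 * m)| ∨
        |l| * (n - y₂) ^ 2 ≤ |B + n * (l * n - 2 * m)| := by
      set D : ℝ := B / l - (m / l) ^ 2 with hD
      have e : ∀ n : ℝ, |B + n * (l * n - 2 * m)| = |l| * |(n - m / l) ^ 2 + D| := by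
        intro n
        rw [← abs_mul, hD]
        congr 1
        field_simp
        ring
      rcases le_total 0 D with h | h
      · refine ⟨m / l, m / l, fun n => Or.inl ?_⟩
        rw [e]
        gcongr
        rw [abs_of_nonneg (by positivity)]
        linarith
      · refine ⟨m / l + √(-D), m / l - √(-D), fun n => ?_⟩
        have hr : √(-D) ^ 2 = -D := Real.sq_sqrt (by linarith)
        have e2 : |(n - m / l) ^ 2 + D| = |n - (m / l + √(-D))| * |n - (m / l - √(-D))| := by
          rw [← abs_mul]
          congr 1
          linear_combination hr
        rw [e, e2]
        rcases le_total |n - (m / l + √(-D))| |n - (m / l - √(-D))| with h3 | h3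
        · left
          rw [← sq_abs (n - _), sq]
          gcongr
        · right
          rw [← sq_abs (n - _), sq]
          gcongr
    have step : ∀ n y : ℝ, |l| * (n - y) ^ 2 ≤ |B + n * (l * n - 2 * m)| →
        jb (B + n * (l * n - 2 * m)) ^ (-(5/8) : ℝ) ≤
          c ^ (-(5/8) : ℝ) * jb (n - y) ^ (-(9/8) : ℝ) := by
      intro n y h
      have h1 : c * jb (n - y) ^ (2 : ℝ) ≤ jb (B + n * (l * n - 2 * m)) := by
        rw [Real.rpow_two]
        unfold jb
        have := sq_abs (n - y)
        have h2 : (1 + |n - y|) ^ 2 ≤ 2 + 2 * (n - y) ^ 2 := by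
          nlinarith [sq_nonneg (|n - y| - 1)]
        have h3 : c * (1 + |n - y|) ^ 2 ≤ c * (2 + 2 * (n - y) ^ 2) := by gcongr
        have h4 : 2 * c * (n - y) ^ 2 ≤ |l| * (n - y) ^ 2 := by gcongr
        nlinarith
      have hj := jb_pos (n - y)
      have h5 := Real.rpow_le_rpow_of_nonpos (z := (-(5/8) : ℝ)) (by positivity) h1 (by norm_num)
      rw [Real.mul_rpow hc0.le (by positivity), ← Real.rpow_mul hj.le] at h5
      refine h5.trans ?_
      gcongr
      · exact jb_one_le _
      · norm_num
    calc _ ≤ ∑' n : ℤ, ENNReal.ofReal (c ^ (-(5/8) : ℝ)) *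
            (ENNReal.ofReal (jb ((n : ℝ) - y₁) ^ (-(9/8) : ℝ)) +
              ENNReal.ofReal (jb ((n : ℝ) - y₂) ^ (-(9/8) : ℝ))) := by
          refine ENNReal.tsum_le_tsum fun n => ?_
          rcases hy n with h | h
          · have := ENNReal.ofReal_le_ofReal (step n y₁ h)
            rw [ENNReal.ofReal_mul (by positivity)] at this
            exact this.trans (by gcongr; exact le_self_add)
          · have := ENNReal.ofReal_le_ofReal (step n y₂ h)
            rw [ENNReal.ofReal_mul (by positivity)] at this
            exact this.trans (by gcongr; exact le_add_self)
      _ ≤ _ := by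
          rw [ENNReal.tsum_mul_left, ENNReal.tsum_add]
          gcongr
          · exact hsum y₁
          · exact hsum y₂
  have h1 : γ + 1 ≠ 0 := by
    intro h
    apply hγ1
    rw [show γ = -1 by linarith]; simp
  have h2 : 1 - γ ≠ 0 := by
    intro h
    apply hγ1
    rw [show γ = 1 by linarith]; simp
  obtain ⟨T₁, hT₁, hb₁⟩ := one _ h1
  obtain ⟨T₂, hT₂, hb₂⟩ := one _ h2
  refine ⟨T₁ + T₂, by simp [hT₁, hT₂], fun B m => ?_⟩
  refine le_trans ?_ (add_le_add (hb₁ B m) (hb₂ B m))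
  rw [← ENNReal.tsum_add]
  refine ENNReal.tsum_le_tsum fun n => ?_
  rcases le_total 0 (n : ℝ) with h | h
  · refine le_trans (le_of_eq ?_) le_self_add
    rw [abs_of_nonneg h]; ring_nf
  · refine le_trans (le_of_eq ?_) le_add_self
    rw [abs_of_nonpos h]; ring_nf

/-- Cauchy--Schwarz with a kernel. -/
lemma cs_kernel {E : Type*} [MeasurableSpace E] (μ : Measure E) [SFinite μ]
    (u : E → ℝ≥0∞) (K v : E × E → ℝ≥0∞) (hu : Measurable u) (hK : Measurable K) (hv : Measurable v)
    (C : ℝ≥0∞) (hC : ∀ x, ∫⁻ y, K (x, y) ^ (2 : ℝ) ∂μ ≤ C) :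
    ∫⁻ x, ∫⁻ y, u x * K (x, y) * v (x, y) ∂μ ∂μ ≤
      C ^ (1/2 : ℝ) * (∫⁻ x, u x ^ (2 : ℝ) ∂μ) ^ (1/2 : ℝ) *
        (∫⁻ x, ∫⁻ y, v (x, y) ^ (2 : ℝ) ∂μ ∂μ) ^ (1/2 : ℝ) := by
  have hA : Measurable (fun p : E × E => u p.1 * K p) := (hu.comp measurable_fst).mul hK
  have e1 : ∫⁻ x, ∫⁻ y, u x * K (x, y) * v (x, y) ∂μ ∂μ
      = ∫⁻ p, ((fun p : E × E => u p.1 * K p) * v) p ∂(μ.prod μ) := by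
    rw [lintegral_prod _ (hA.mul hv).aemeasurable]
    rfl
  rw [e1]
  refine (ENNReal.lintegral_mul_le_Lp_mul_Lq (μ.prod μ)
    (Real.HolderConjugate.two_two) hA.aemeasurable hv.aemeasurable).trans ?_
  rw [← ENNReal.mul_rpow_of_nonneg C _ (by norm_num : (0:ℝ) ≤ 1/2)]
  rw [lintegral_prod _ (hv.pow_const _).aemeasurable,
    lintegral_prod _ (hA.pow_const _).aemeasurable]
  gcongr
  simp_rw [ENNReal.mul_rpow_of_nonneg _ _ (by norm_num : (0:ℝ) ≤ 2)]
  rw [← lintegral_const_mul _ (hu.pow_const _)]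
  refine lintegral_mono fun x => ?_
  dsimp only
  rw [lintegral_const_mul _ (by fun_prop), mul_comm]
  gcongr
  exact hC x

lemma lint_sub_right (F : ℝ × ℤ → ℝ≥0∞) (x : ℝ × ℤ) :
    ∫⁻ y, F (y - x) ∂muE = ∫⁻ y, F y ∂muE := lintegral_sub_right_eq_self F x

lemma lint_sub_left (F : ℝ × ℤ → ℝ≥0∞) (x : ℝ × ℤ) :
    ∫⁻ y, F (x - y) ∂muE = ∫⁻ y, F y ∂muE := lintegral_sub_left_eq_self F x

/-- L² norm, abstractly. -/
noncomputable def nrm (f : ℝ × ℤ → ℝ≥0∞) : ℝ≥0∞ := (∫⁻ x, f x ^ (2 : ℝ) ∂muE) ^ (1/2 : ℝ)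

lemma formA (f g h : ℝ × ℤ → ℝ≥0∞) (hf : Measurable f) (hg : Measurable g) (hh : Measurable h)
    (K : (ℝ × ℤ) × (ℝ × ℤ) → ℝ≥0∞) (hK : Measurable K) (C : ℝ≥0∞)
    (hC : ∀ x, ∫⁻ y, K (x, y) ^ (2 : ℝ) ∂muE ≤ C) :
    ∫⁻ x, ∫⁻ y, h x * f y * g (x - y) * K (x, y) ∂muE ∂muE ≤
      C ^ (1/2 : ℝ) * (nrm f * nrm g * nrm h) := by
  have := cs_kernel muE h K (fun p => f p.2 * g (p.1 - p.2)) hh hK (by fun_prop) C hC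
  have e : ∫⁻ x, ∫⁻ y, (f y * g (x - y)) ^ (2 : ℝ) ∂muE ∂muE =
      (∫⁻ x, f x ^ (2 : ℝ) ∂muE) * (∫⁻ x, g x ^ (2 : ℝ) ∂muE) := by
    rw [lintegral_lintegral_swap (by fun_prop)]
    simp_rw [ENNReal.mul_rpow_of_nonneg _ _ (by norm_num : (0:ℝ) ≤ 2)]
    rw [← lintegral_mul_const _ (by fun_prop)]
    refine lintegral_congr fun y => ?_
    rw [lintegral_const_mul _ (by fun_prop), lint_sub_right (fun z => g z ^ (2:ℝ)) y]
  dsimp only at this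
  rw [e, ENNReal.mul_rpow_of_nonneg _ _ (by norm_num : (0:ℝ) ≤ 1/2)] at this
  unfold nrm
  calc _ = ∫⁻ x, ∫⁻ y, h x * K (x, y) * (f y * g (x - y)) ∂muE ∂muE := by
        congr! 4; ring
    _ ≤ _ := this
    _ = _ := by ring

lemma formB (f g h : ℝ × ℤ → ℝ≥0∞) (hf : Measurable f) (hg : Measurable g) (hh : Measurable h)
    (K : (ℝ × ℤ) × (ℝ × ℤ) → ℝ≥0∞) (hK : Measurable K) (C : ℝ≥0∞)
    (hC : ∀ y, ∫⁻ x, K (x, y) ^ (2 : ℝ) ∂muE ≤ C) :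
    ∫⁻ x, ∫⁻ y, h x * f y * g (x - y) * K (x, y) ∂muE ∂muE ≤
      C ^ (1/2 : ℝ) * (nrm f * nrm g * nrm h) := by
  have := cs_kernel muE f (fun p => K (p.2, p.1)) (fun p => h p.2 * g (p.2 - p.1)) hf
    (by fun_prop) (by fun_prop) C hC
  have e : ∫⁻ x, ∫⁻ y, (h y * g (y - x)) ^ (2 : ℝ) ∂muE ∂muE =
      (∫⁻ x, h x ^ (2 : ℝ) ∂muE) * (∫⁻ x, g x ^ (2 : ℝ) ∂muE) := by
    rw [lintegral_lintegral_swap (by fun_prop)]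
    simp_rw [ENNReal.mul_rpow_of_nonneg _ _ (by norm_num : (0:ℝ) ≤ 2)]
    rw [← lintegral_mul_const _ (by fun_prop)]
    refine lintegral_congr fun y => ?_
    rw [lintegral_const_mul _ (by fun_prop), lint_sub_left (fun z => g z ^ (2:ℝ)) y]
  dsimp only at this
  rw [e, ENNReal.mul_rpow_of_nonneg _ _ (by norm_num : (0:ℝ) ≤ 1/2)] at this
  unfold nrm
  rw [lintegral_lintegral_swap (by fun_prop)]
  calc _ = ∫⁻ x, ∫⁻ y, f x * K (y, x) * (h y * g (y - x)) ∂muE ∂muE := by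
        congr! 4; ring
    _ ≤ _ := this
    _ = _ := by ring

lemma formC (f g h : ℝ × ℤ → ℝ≥0∞) (hf : Measurable f) (hg : Measurable g) (hh : Measurable h)
    (K : (ℝ × ℤ) × (ℝ × ℤ) → ℝ≥0∞) (hK : Measurable K) (C : ℝ≥0∞)
    (hC : ∀ z, ∫⁻ x, K (x, x - z) ^ (2 : ℝ) ∂muE ≤ C) :
    ∫⁻ x, ∫⁻ y, h x * f y * g (x - y) * K (x, y) ∂muE ∂muE ≤
      C ^ (1/2 : ℝ) * (nrm f * nrm g * nrm h) := by
  have := formB g f h hg hf hh (fun p => K (p.1, p.1 - p.2)) (by fun_prop) C hC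
  calc _ = ∫⁻ x, ∫⁻ y, h x * g y * f (x - y) * K (x, x - y) ∂muE ∂muE := by
        refine lintegral_congr fun x => ?_
        rw [← lint_sub_left _ x]
        refine lintegral_congr fun y => ?_
        have hxy : x - (x - y) = y := by ext <;> simp
        rw [hxy]; ring
    _ ≤ _ := this
    _ = _ := by ring

lemma pw_facts (γ : ℝ) (hγ1 : |γ| ≠ 1) : ∃ C : ℝ, 0 < C ∧ ∀ n n₁ : ℝ, 1 ≤ |n| →
    |n| * jb n₁ ^ (-(1/2) : ℝ) * jb (n - n₁) ^ (-(1/2) : ℝ) ≤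
      C * jb (n * (γ * |n| + n - 2 * n₁)) ^ (1/2 : ℝ) ∧
    |n| * jb n₁ ^ (-(1/2) : ℝ) * jb (n - n₁) ^ (-(1/2) : ℝ)
        * jb (n * (γ * |n| + n - 2 * n₁)) ^ (-(3/8) : ℝ) ≤
      C * (jb n₁ ^ (-(1/4) : ℝ) + jb (γ * |n| + n - 2 * n₁) ^ (-(1/4) : ℝ)) := by
  set d : ℝ := |(|γ| - 1)| with hd
  have hd0 : 0 < d := by
    rw [hd, abs_pos]; intro h; apply hγ1; linarith
  have hδ0 : 0 < d / 2 := by positivity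
  refine ⟨(d/2) ^ (-(1/2) : ℝ) + (d/2) ^ (-(3/8) : ℝ) + 4 / d, by positivity, ?_⟩
  intro n n₁ hn
  set k := γ * |n| + n - 2 * n₁ with hk
  set P := jb n₁ with hP
  set Q := jb (n - n₁) with hQ
  set R := jb (n * k) with hR
  have hP1 : 1 ≤ P := jb_one_le _
  have hQ1 : 1 ≤ Q := jb_one_le _
  have hR1 : 1 ≤ R := jb_one_le _
  have hk1 : 1 ≤ jb k := jb_one_le _
  have hn0 : 0 < |n| := by linarith
  have hPQ : |n| ≤ P * Q := by
    have := jb_add_le n₁ (n - n₁)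
    rw [add_sub_cancel] at this
    refine le_trans ?_ this
    unfold jb; linarith
  have c1 : 0 < (d/2) ^ (-(1/2) : ℝ) := by positivity
  have c2 : 0 < (d/2) ^ (-(3/8) : ℝ) := by positivity
  have c3 : 0 < 4 / d := by positivity
  have P2 : P ^ (-(1/2) : ℝ) ≤ 1 := Real.rpow_le_one_of_one_le_of_nonpos hP1 (by norm_num)
  have Q2 : Q ^ (-(1/2) : ℝ) ≤ 1 := Real.rpow_le_one_of_one_le_of_nonpos hQ1 (by norm_num)
  have Q4 : Q ^ (-(1/4) : ℝ) ≤ 1 := Real.rpow_le_one_of_one_le_of_nonpos hQ1 (by norm_num)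
  have hP0 : 0 < P := by linarith
  have hQ0 : 0 < Q := by linarith
  have hR0 : 0 < R := by linarith
  have hk0 : 0 < jb k := by linarith
  rcases le_or_gt (d / 2 * |n|) |k| with hc | hc
  · have hRn : d / 2 * |n| ^ (2 : ℝ) ≤ R := by
      rw [hR, Real.rpow_two]; unfold jb
      rw [abs_mul]
      nlinarith
    constructor
    · have h1 : |n| * P ^ (-(1/2) : ℝ) * Q ^ (-(1/2) : ℝ) ≤ |n| := by
        calc _ ≤ |n| * 1 * 1 := by gcongr
          _ = _ := by ring
      have h2 : (d / 2 * |n| ^ (2 : ℝ)) ^ (1/2 : ℝ) ≤ R ^ (1/2 : ℝ) := by gcongr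
      rw [Real.mul_rpow (by positivity) (by positivity), ← Real.rpow_mul hn0.le] at h2
      norm_num at h2
      have h3 : (d/2) ^ (-(1/2) : ℝ) * (d/2) ^ (1/2 : ℝ) = 1 := by
        rw [← Real.rpow_add hδ0]; norm_num
      calc _ ≤ |n| := h1
        _ = (d/2) ^ (-(1/2) : ℝ) * ((d/2) ^ (1/2 : ℝ) * |n|) := by rw [← mul_assoc, h3, one_mul]
        _ ≤ (d/2) ^ (-(1/2) : ℝ) * R ^ (1/2 : ℝ) := by gcongr
        _ ≤ _ := by gcongr; linarith
    · have h2 := Real.rpow_le_rpow_of_nonpos (z := (-(3/8) : ℝ)) (by positivity) hRn (by norm_num)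
      rw [Real.mul_rpow (by positivity) (by positivity), ← Real.rpow_mul hn0.le] at h2
      have e1 : |n| * |n| ^ ((2 : ℝ) * -(3/8)) = |n| ^ (1/4 : ℝ) := by
        nth_rewrite 1 [← Real.rpow_one |n|]
        rw [← Real.rpow_add hn0]; norm_num
      have e2 : |n| ^ (1/4 : ℝ) ≤ P ^ (1/4 : ℝ) * Q ^ (1/4 : ℝ) := by
        rw [← Real.mul_rpow hP0.le hQ0.le]; gcongr
      have e3 : P ^ (1/4 : ℝ) * P ^ (-(1/2) : ℝ) = P ^ (-(1/4) : ℝ) := by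
        rw [← Real.rpow_add hP0]; norm_num
      have e4 : Q ^ (1/4 : ℝ) * Q ^ (-(1/2) : ℝ) = Q ^ (-(1/4) : ℝ) := by
        rw [← Real.rpow_add hQ0]; norm_num
      calc _ ≤ |n| * P ^ (-(1/2) : ℝ) * Q ^ (-(1/2) : ℝ) *
            ((d/2) ^ (-(3/8) : ℝ) * |n| ^ ((2 : ℝ) * -(3/8))) := by gcongr
        _ = (d/2) ^ (-(3/8) : ℝ) * (|n| ^ (1/4 : ℝ)) * P ^ (-(1/2) : ℝ) * Q ^ (-(1/2) : ℝ) := by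
            rw [← e1]; ring
        _ ≤ (d/2) ^ (-(3/8) : ℝ) * (P ^ (1/4 : ℝ) * Q ^ (1/4 : ℝ)) * P ^ (-(1/2) : ℝ) * Q ^ (-(1/2) : ℝ) := by
            gcongr
        _ = (d/2) ^ (-(3/8) : ℝ) * (P ^ (-(1/4) : ℝ) * Q ^ (-(1/4) : ℝ)) := by
            rw [← e3, ← e4]; ring
        _ ≤ (d/2) ^ (-(3/8) : ℝ) * (P ^ (-(1/4) : ℝ) * 1) := by gcongr
        _ ≤ _ := by
            gcongr
            · linarith
            · rw [mul_one]
              have := Real.rpow_pos_of_pos hk0 (-(1/4))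
              linarith
  · -- resonant case
    have hlow : ∀ t : ℝ, |t| = |γ| * |n| → d * |n| ≤ |t + n| := by
      intro t ht
      have h1 := abs_abs_sub_abs_le_abs_sub t (-n)
      rw [abs_neg, ht, sub_neg_eq_add] at h1
      refine le_trans (le_of_eq ?_) h1
      rw [hd, ← sub_one_mul, abs_mul, abs_abs]
    have g1 := hlow (γ * |n|) (by rw [abs_mul, abs_abs])
    have g2 := hlow (-(γ * |n|)) (by rw [abs_neg, abs_mul, abs_abs])
    have hn1 : d / 4 * |n| ≤ |n₁| := by
      have h1 : γ * |n| + n = k + 2 * n₁ := by rw [hk]; ring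
      rw [h1] at g1
      have h2 := abs_add_le k (2 * n₁)
      rw [abs_mul 2, abs_two] at h2
      linarith
    have hn2 : d / 4 * |n| ≤ |n - n₁| := by
      have h1 : -(γ * |n|) + n = 2 * (n - n₁) - k := by rw [hk]; ring
      rw [h1] at g2
      have h2 := abs_sub (2 * (n - n₁)) k
      rw [abs_mul 2, abs_two] at h2
      linarith
    have hm0 : 0 < d / 4 * |n| := by positivity
    have hP' : P ^ (-(1/2) : ℝ) ≤ (d / 4 * |n|) ^ (-(1/2) : ℝ) :=
      Real.rpow_le_rpow_of_nonpos hm0 (by rw [hP]; unfold jb; linarith) (by norm_num)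
    have hQ' : Q ^ (-(1/2) : ℝ) ≤ (d / 4 * |n|) ^ (-(1/2) : ℝ) :=
      Real.rpow_le_rpow_of_nonpos hm0 (by rw [hQ]; unfold jb; linarith) (by norm_num)
    have hW : |n| * P ^ (-(1/2) : ℝ) * Q ^ (-(1/2) : ℝ) ≤ 4 / d := by
      calc _ ≤ |n| * (d / 4 * |n|) ^ (-(1/2) : ℝ) * (d / 4 * |n|) ^ (-(1/2) : ℝ) := by gcongr
        _ = |n| * (d / 4 * |n|)⁻¹ := by
            rw [mul_assoc, ← Real.rpow_add hm0, ← Real.rpow_neg_one]; norm_num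
        _ = _ := by field_simp
    constructor
    · calc _ ≤ 4 / d * 1 := by rw [mul_one]; exact hW
        _ ≤ _ := by
          gcongr
          · linarith
          · exact Real.one_le_rpow hR1 (by norm_num)
    · have hRk : jb k ≤ R := by
        rw [hR]; unfold jb; rw [abs_mul]; nlinarith [abs_nonneg k]
      calc _ ≤ 4 / d * jb k ^ (-(1/4) : ℝ) := by
            gcongr
            calc R ^ (-(3/8) : ℝ) ≤ jb k ^ (-(3/8) : ℝ) :=
                  Real.rpow_le_rpow_of_nonpos hk0 hRk (by norm_num)
              _ ≤ _ := Real.rpow_le_rpow_of_exponent_le hk1 (by norm_num)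
        _ ≤ _ := by
          gcongr
          · linarith
          · have := Real.rpow_pos_of_pos hP0 (-(1/4))
            linarith

lemma pw_main (γ s : ℝ) (hγ1 : |γ| ≠ 1) (hs : 1/2 ≤ s) : ∃ C : ℝ, 0 < C ∧ ∀ a b c n n₁ : ℝ,
    1 ≤ |n| → a - b - c = n * (γ * |n| + n - 2 * n₁) →
    |n| * jb n ^ (s - 1/2) / (jb a ^ (3/8 : ℝ) * jb n₁ ^ s * jb b ^ (1/2 : ℝ) *
      jb (n - n₁) ^ s * jb c ^ (1/2 : ℝ)) ≤
    C * ((jb n₁ ^ (-(1/4) : ℝ) + jb (γ * |n| + n - 2 * n₁) ^ (-(1/4) : ℝ)) *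
        jb b ^ (-(1/2) : ℝ) * jb c ^ (-(1/2) : ℝ)
      + jb a ^ (-(3/8) : ℝ) * jb c ^ (-(1/2) : ℝ)
      + jb a ^ (-(3/8) : ℝ) * jb b ^ (-(1/2) : ℝ)) := by
  obtain ⟨C, hC, hfacts⟩ := pw_facts γ hγ1
  refine ⟨3 * C, by positivity, ?_⟩
  intro a b c n n₁ hn hres
  obtain ⟨f1, f2⟩ := hfacts n n₁ hn
  rw [← hres] at f1 f2
  set k := γ * |n| + n - 2 * n₁
  have hRle : jb (a - b - c) ≤ jb a + jb b + jb c := by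
    unfold jb
    have h1 := abs_sub (a - b) c
    have h2 := abs_sub a b
    linarith
  have hPQ : jb n ≤ jb n₁ * jb (n - n₁) := by
    have := jb_add_le n₁ (n - n₁)
    rwa [add_sub_cancel] at this
  have hP := jb_pos n₁
  have hQ := jb_pos (n - n₁)
  have hN := jb_pos n
  have hk := jb_pos k
  have hA := jb_pos a
  have hB := jb_pos b
  have hD := jb_pos c
  have hR := jb_pos (a - b - c)
  generalize jb (a - b - c) = R at *
  generalize jb n₁ = P at *
  generalize jb (n - n₁) = Q at *
  generalize jb n = N at *
  generalize jb k = k at *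
  generalize jb a = A at *
  generalize jb b = B at *
  generalize jb c = D at *
  have hw : |n| * N ^ (s - 1/2) / (A ^ (3/8 : ℝ) * P ^ s * B ^ (1/2 : ℝ) * Q ^ s * D ^ (1/2 : ℝ))
      ≤ |n| * P ^ (-(1/2) : ℝ) * Q ^ (-(1/2) : ℝ) * A ^ (-(3/8) : ℝ) * B ^ (-(1/2) : ℝ) * D ^ (-(1/2) : ℝ) := by
    have hNs : N ^ (s - 1/2) ≤ P ^ (s - 1/2) * Q ^ (s - 1/2) := by
      rw [← Real.mul_rpow hP.le hQ.le]
      exact Real.rpow_le_rpow hN.le hPQ (by linarith)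
    have eP : P ^ (s - 1/2) * (P ^ s)⁻¹ = P ^ (-(1/2) : ℝ) := by
      rw [← Real.rpow_neg hP.le, ← Real.rpow_add hP]; ring_nf
    have eQ : Q ^ (s - 1/2) * (Q ^ s)⁻¹ = Q ^ (-(1/2) : ℝ) := by
      rw [← Real.rpow_neg hQ.le, ← Real.rpow_add hQ]; ring_nf
    calc _ ≤ |n| * (P ^ (s - 1/2) * Q ^ (s - 1/2)) /
          (A ^ (3/8 : ℝ) * P ^ s * B ^ (1/2 : ℝ) * Q ^ s * D ^ (1/2 : ℝ)) := by gcongr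
      _ = _ := by
        rw [← eP, ← eQ, Real.rpow_neg hA.le, Real.rpow_neg hB.le, Real.rpow_neg hD.le]
        simp only [div_eq_mul_inv, mul_inv]
        ring
  refine hw.trans ?_
  generalize hWdef : |n| * P ^ (-(1/2) : ℝ) * Q ^ (-(1/2) : ℝ) = W at *
  have hW0 : 0 ≤ W := by rw [← hWdef]; positivity
  have t1 : 0 < (P ^ (-(1/4) : ℝ) + k ^ (-(1/4) : ℝ)) * B ^ (-(1/2) : ℝ) * D ^ (-(1/2) : ℝ) := by
    positivity
  have t2 : 0 < A ^ (-(3/8) : ℝ) * D ^ (-(1/2) : ℝ) := by positivity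
  have t3 : 0 < A ^ (-(3/8) : ℝ) * B ^ (-(1/2) : ℝ) := by positivity
  have big : ∀ X : ℝ, 0 < X → R ≤ 3 * X → W * X ^ (-(1/2) : ℝ) ≤ 3 * C := by
    intro X hX hRX
    have h1 : R ^ (1/2 : ℝ) ≤ 3 * X ^ (1/2 : ℝ) := by
      calc R ^ (1/2 : ℝ) ≤ (3 * X) ^ (1/2 : ℝ) := by gcongr
        _ = 3 ^ (1/2 : ℝ) * X ^ (1/2 : ℝ) := Real.mul_rpow (by norm_num) hX.le
        _ ≤ 3 ^ (1 : ℝ) * X ^ (1/2 : ℝ) := by gcongr <;> norm_num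
        _ = _ := by norm_num
    have h2 : X ^ (1/2 : ℝ) * X ^ (-(1/2) : ℝ) = 1 := by
      rw [← Real.rpow_add hX]; norm_num
    calc W * X ^ (-(1/2) : ℝ) ≤ (C * (3 * X ^ (1/2 : ℝ))) * X ^ (-(1/2) : ℝ) := by
          gcongr
          exact f1.trans (by gcongr)
      _ = 3 * C * (X ^ (1/2 : ℝ) * X ^ (-(1/2) : ℝ)) := by ring
      _ = _ := by rw [h2, mul_one]
  by_cases hb : A ≤ B ∧ D ≤ B
  · have := big B hB (by linarith [hb.1, hb.2])
    calc _ = W * B ^ (-(1/2) : ℝ) * (A ^ (-(3/8) : ℝ) * D ^ (-(1/2) : ℝ)) := by ring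
      _ ≤ 3 * C * (A ^ (-(3/8) : ℝ) * D ^ (-(1/2) : ℝ)) := by gcongr
      _ ≤ _ := by gcongr; linarith
  by_cases hd : A ≤ D ∧ B ≤ D
  · have := big D hD (by linarith [hd.1, hd.2])
    calc _ = W * D ^ (-(1/2) : ℝ) * (A ^ (-(3/8) : ℝ) * B ^ (-(1/2) : ℝ)) := by ring
      _ ≤ 3 * C * (A ^ (-(3/8) : ℝ) * B ^ (-(1/2) : ℝ)) := by gcongr
      _ ≤ _ := by gcongr; linarith
  have hmax : R ≤ 3 * A := by
    rcases le_total A B with h1 | h1 <;> rcases le_total A D with h2 | h2 <;>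
      rcases le_total B D with h3 | h3 <;> first | linarith | (exfalso; tauto)
  have hA3 : A ^ (-(3/8) : ℝ) ≤ 3 * R ^ (-(3/8) : ℝ) := by
    have h1 := Real.rpow_le_rpow_of_nonpos (z := (-(3/8) : ℝ)) hR hmax (by norm_num)
    rw [Real.mul_rpow (by norm_num) hA.le] at h1
    have h4 : (1/3 : ℝ) ≤ 3 ^ (-(3/8) : ℝ) := by
      have : (3:ℝ) ^ (-1 : ℝ) ≤ 3 ^ (-(3/8) : ℝ) :=
        Real.rpow_le_rpow_of_exponent_le (by norm_num) (by norm_num)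
      rw [Real.rpow_neg_one] at this
      linarith
    have h5 : 0 < A ^ (-(3/8) : ℝ) := Real.rpow_pos_of_pos hA _
    nlinarith
  calc _ = W * A ^ (-(3/8) : ℝ) * B ^ (-(1/2) : ℝ) * D ^ (-(1/2) : ℝ) := by ring
    _ ≤ W * (3 * R ^ (-(3/8) : ℝ)) * B ^ (-(1/2) : ℝ) * D ^ (-(1/2) : ℝ) := by gcongr
    _ = 3 * (W * R ^ (-(3/8) : ℝ)) * B ^ (-(1/2) : ℝ) * D ^ (-(1/2) : ℝ) := by ring
    _ ≤ 3 * (C * (P ^ (-(1/4) : ℝ) + k ^ (-(1/4) : ℝ))) * B ^ (-(1/2) : ℝ) * D ^ (-(1/2) : ℝ) := by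
        gcongr
    _ = 3 * C * ((P ^ (-(1/4) : ℝ) + k ^ (-(1/4) : ℝ)) * B ^ (-(1/2) : ℝ) * D ^ (-(1/2) : ℝ)) := by ring
    _ ≤ _ := by gcongr; linarith

lemma int_pair : ∃ I : ℝ≥0∞, I ≠ ⊤ ∧ ∀ p q : ℝ,
    ∫⁻ τ : ℝ, ENNReal.ofReal (jb (τ + p) ^ (-(3/4) : ℝ) * jb (τ + q) ^ (-1 : ℝ)) ≤
      I * ENNReal.ofReal (jb (p - q) ^ (-(5/8) : ℝ)) := by
  obtain ⟨I, hI, hIntB⟩ := int_bound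
  refine ⟨ENNReal.ofReal 2 * (I + I), ENNReal.mul_ne_top ENNReal.ofReal_ne_top (by simp [hI]), ?_⟩
  intro p q
  have hm := measurable_jb
  have sh : ∀ p : ℝ, ∫⁻ τ : ℝ, ENNReal.ofReal (jb (τ + p) ^ (-(9/8) : ℝ)) = I := by
    intro p
    rw [← hIntB]
    exact lintegral_add_right_eq_self (fun τ => ENNReal.ofReal (jb τ ^ (-(9/8) : ℝ))) p
  have hp : 0 ≤ 2 * jb (p - q) ^ (-(5/8) : ℝ) :=
    mul_nonneg two_pos.le (Real.rpow_nonneg (jb_pos _).le _)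
  calc _ ≤ ∫⁻ τ : ℝ, ENNReal.ofReal (2 * jb (p - q) ^ (-(5/8) : ℝ)) *
        (ENNReal.ofReal (jb (τ + p) ^ (-(9/8) : ℝ)) + ENNReal.ofReal (jb (τ + q) ^ (-(9/8) : ℝ))) := by
        refine lintegral_mono fun τ => ?_
        have h := key_ineq (τ + p) (τ + q)
        rw [add_sub_add_left_eq_sub] at h
        rw [← ENNReal.ofReal_add (Real.rpow_nonneg (jb_pos _).le _) (Real.rpow_nonneg (jb_pos _).le _),
          ← ENNReal.ofReal_mul hp]
        exact ENNReal.ofReal_le_ofReal h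
    _ = _ := by
        rw [lintegral_const_mul _ (by fun_prop), lintegral_add_left (by fun_prop), sh, sh,
          ENNReal.ofReal_mul two_pos.le]
        ring

/-- Kernels. -/
noncomputable def kerA (γ : ℝ) (p : (ℝ × ℤ) × (ℝ × ℤ)) : ℝ≥0∞ :=
  if p.1.2 = 0 then 0 else ENNReal.ofReal
    ((jb (p.2.2 : ℝ) ^ (-(1/4) : ℝ) +
      jb (γ * |(p.1.2 : ℝ)| + p.1.2 - 2 * p.2.2) ^ (-(1/4) : ℝ)) *
      jb (p.2.1 + (p.2.2 : ℝ) ^ 2) ^ (-(1/2) : ℝ) *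
      jb (p.1.1 - p.2.1 - ((p.1.2 : ℝ) - (p.2.2 : ℝ)) ^ 2) ^ (-(1/2) : ℝ))

noncomputable def kerB (γ : ℝ) (p : (ℝ × ℤ) × (ℝ × ℤ)) : ℝ≥0∞ :=
  ENNReal.ofReal (jb (p.1.1 + γ * |(p.1.2 : ℝ)| * (p.1.2 : ℝ)) ^ (-(3/8) : ℝ) *
      jb (p.1.1 - p.2.1 - ((p.1.2 : ℝ) - (p.2.2 : ℝ)) ^ 2) ^ (-(1/2) : ℝ))

noncomputable def kerC (γ : ℝ) (p : (ℝ × ℤ) × (ℝ × ℤ)) : ℝ≥0∞ :=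
  ENNReal.ofReal (jb (p.1.1 + γ * |(p.1.2 : ℝ)| * (p.1.2 : ℝ)) ^ (-(3/8) : ℝ) *
      jb (p.2.1 + (p.2.2 : ℝ) ^ 2) ^ (-(1/2) : ℝ))

lemma meas_cast : Measurable (fun n : ℤ => (n : ℝ)) := Measurable.of_discrete

lemma meas_kerA (γ : ℝ) : Measurable (kerA γ) := by
  have h1 := measurable_jb
  have h2 := meas_cast
  have c1 : Measurable (fun p : (ℝ × ℤ) × (ℝ × ℤ) => ((p.1.2 : ℤ) : ℝ)) := h2.comp (by fun_prop)
  have c2 : Measurable (fun p : (ℝ × ℤ) × (ℝ × ℤ) => ((p.2.2 : ℤ) : ℝ)) := h2.comp (by fun_prop)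
  unfold kerA
  refine Measurable.ite ?_ measurable_const (by fun_prop)
  exact measurableSet_eq_fun (by fun_prop) measurable_const

lemma meas_kerB (γ : ℝ) : Measurable (kerB γ) := by
  have h1 := measurable_jb
  have h2 := meas_cast
  have c1 : Measurable (fun p : (ℝ × ℤ) × (ℝ × ℤ) => ((p.1.2 : ℤ) : ℝ)) := h2.comp (by fun_prop)
  have c2 : Measurable (fun p : (ℝ × ℤ) × (ℝ × ℤ) => ((p.2.2 : ℤ) : ℝ)) := h2.comp (by fun_prop)
  unfold kerB
  fun_prop

lemma meas_kerC (γ : ℝ) : Measurable (kerC γ) := by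
  have h1 := measurable_jb
  have h2 := meas_cast
  have c1 : Measurable (fun p : (ℝ × ℤ) × (ℝ × ℤ) => ((p.1.2 : ℤ) : ℝ)) := h2.comp (by fun_prop)
  have c2 : Measurable (fun p : (ℝ × ℤ) × (ℝ × ℤ) => ((p.2.2 : ℤ) : ℝ)) := h2.comp (by fun_prop)
  unfold kerC
  fun_prop

lemma sq_pow (u r q : ℝ) (h : r * 2 = q) : (jb u ^ r) ^ (2:ℝ) = jb u ^ q := by
  rw [← Real.rpow_mul (jb_pos u).le, h]

lemma boundB (γ : ℝ) (hγ1 : |γ| ≠ 1) : ∃ C : ℝ≥0∞, C ≠ ⊤ ∧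
    ∀ y, ∫⁻ x, kerB γ (x, y) ^ (2 : ℝ) ∂muE ≤ C := by
  obtain ⟨I, hI, hIntB⟩ := int_pair
  obtain ⟨S, hS, hquad⟩ := quad_bound γ hγ1
  refine ⟨I * S, ENNReal.mul_ne_top hI hS, ?_⟩
  rintro ⟨t, m⟩
  have hm := meas_kerB γ
  rw [lintegral_muE _ (by fun_prop)]
  refine le_trans ?_ (mul_le_mul_right (hquad (t + (m:ℝ) ^ 2) m) I)
  rw [← ENNReal.tsum_mul_left]
  refine ENNReal.tsum_le_tsum fun n => ?_
  have h := hIntB (γ * |(n : ℝ)| * n) (-t - ((n : ℝ) - m) ^ 2)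
  convert h using 1
  · refine lintegral_congr fun τ => ?_
    have p1 := jb_pos (τ + γ * |(n : ℝ)| * n)
    have p2 := jb_pos (τ - t - ((n : ℝ) - m) ^ 2)
    unfold kerB
    rw [ENNReal.ofReal_rpow_of_nonneg (by positivity) (by norm_num),
      Real.mul_rpow (by positivity) (by positivity), sq_pow _ _ (-(3/4)) (by norm_num),
      sq_pow _ _ (-1) (by norm_num)]
    ring_nf
  · ring_nf

lemma boundC (γ : ℝ) (hγ1 : |γ| ≠ 1) : ∃ C : ℝ≥0∞, C ≠ ⊤ ∧
    ∀ z, ∫⁻ x, kerC γ (x, x - z) ^ (2 : ℝ) ∂muE ≤ C := by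
  obtain ⟨I, hI, hIntB⟩ := int_pair
  obtain ⟨S, hS, hquad⟩ := quad_bound (-γ) (by rwa [abs_neg])
  refine ⟨I * S, ENNReal.mul_ne_top hI hS, ?_⟩
  rintro ⟨t, m⟩
  have hm := meas_kerC γ
  rw [lintegral_muE _ (by fun_prop)]
  refine le_trans ?_ (mul_le_mul_right (hquad (-t + (m:ℝ) ^ 2) m) I)
  rw [← ENNReal.tsum_mul_left]
  refine ENNReal.tsum_le_tsum fun n => ?_
  have h := hIntB (γ * |(n : ℝ)| * n) (-t + ((n : ℝ) - m) ^ 2)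
  convert h using 1
  · refine lintegral_congr fun τ => ?_
    have p1 := jb_pos (τ + γ * |(n : ℝ)| * n)
    have p2 := jb_pos (τ - t + (((n - m : ℤ)) : ℝ) ^ 2)
    unfold kerC
    simp only [Prod.mk_sub_mk]
    rw [ENNReal.ofReal_rpow_of_nonneg (by positivity) (by norm_num),
      Real.mul_rpow (by positivity) (by positivity), sq_pow _ _ (-(3/4)) (by norm_num),
      sq_pow _ _ (-1) (by norm_num)]
    push_cast
    ring_nf
  · rw [← jb_neg]
    ring_nf

lemma young_pt (u v : ℝ) : jb u ^ (-(1/2) : ℝ) * jb v ^ (-(5/8) : ℝ) ≤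
    jb u ^ (-(9/8) : ℝ) + jb v ^ (-(9/8) : ℝ) := by
  have pu := jb_pos u
  have pv := jb_pos v
  rcases le_total (jb u) (jb v) with h | h
  · have h1 := Real.rpow_le_rpow_of_nonpos (z := (-(5/8) : ℝ)) pu h (by norm_num)
    calc _ ≤ jb u ^ (-(1/2) : ℝ) * jb u ^ (-(5/8) : ℝ) := by gcongr
      _ = jb u ^ (-(9/8) : ℝ) := by rw [← Real.rpow_add pu]; norm_num
      _ ≤ _ := by have := Real.rpow_pos_of_pos pv (-(9/8)); linarith
  · have h1 := Real.rpow_le_rpow_of_nonpos (z := (-(1/2) : ℝ)) pv h (by norm_num)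
    calc _ ≤ jb v ^ (-(1/2) : ℝ) * jb v ^ (-(5/8) : ℝ) := by gcongr
      _ = jb v ^ (-(9/8) : ℝ) := by rw [← Real.rpow_add pv]; norm_num
      _ ≤ _ := by have := Real.rpow_pos_of_pos pu (-(9/8)); linarith

lemma jb_anti (u v : ℝ) (h : |u| ≤ |v|) : jb v ^ (-(9/8) : ℝ) ≤ jb u ^ (-(9/8) : ℝ) :=
  Real.rpow_le_rpow_of_nonpos (jb_pos u) (by unfold jb; linarith) (by norm_num)

lemma boundA (γ : ℝ) : ∃ C : ℝ≥0∞, C ≠ ⊤ ∧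
    ∀ x, ∫⁻ y, kerA γ (x, y) ^ (2 : ℝ) ∂muE ≤ C := by
  obtain ⟨I, hI, hIntB⟩ := int_pair
  obtain ⟨S, hS, hsum⟩ := sum_bound
  refine ⟨ENNReal.ofReal 2 * I * (S + S + (S + S)), ENNReal.mul_ne_top
    (ENNReal.mul_ne_top ENNReal.ofReal_ne_top hI) (by simp [hS]), ?_⟩
  rintro ⟨t, n⟩
  by_cases hn : n = 0
  · simp [kerA, hn]
  have hm := meas_kerA γ
  have hmj := measurable_jb
  rw [lintegral_muE _ (by fun_prop)]
  have hnR : (n : ℝ) ≠ 0 := by exact_mod_cast hn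
  have hn1 : 1 ≤ |(n : ℝ)| := by exact_mod_cast Int.one_le_abs hn
  set y₁ : ℝ := (γ * |(n : ℝ)| + n) / 2 with hy₁
  set y₂ : ℝ := ((n : ℝ) ^ 2 - t) / (2 * n) with hy₂
  have hbd : ENNReal.ofReal 2 * I * (∑' m : ℤ,
      (ENNReal.ofReal (jb ((m : ℝ) - 0) ^ (-(9/8) : ℝ)) +
        ENNReal.ofReal (jb ((m : ℝ) - y₂) ^ (-(9/8) : ℝ)) +
       (ENNReal.ofReal (jb ((m : ℝ) - y₁) ^ (-(9/8) : ℝ)) +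
        ENNReal.ofReal (jb ((m : ℝ) - y₂) ^ (-(9/8) : ℝ))))) ≤
      ENNReal.ofReal 2 * I * (S + S + (S + S)) := by
    rw [ENNReal.tsum_add, ENNReal.tsum_add, ENNReal.tsum_add]
    gcongr <;> apply hsum
  refine le_trans ?_ hbd
  rw [← ENNReal.tsum_mul_left]
  refine ENNReal.tsum_le_tsum fun m => ?_
  set k : ℝ := γ * |(n : ℝ)| + n - 2 * m with hk
  have pm := jb_pos (m : ℝ)
  have pk := jb_pos k
  set X : ℝ := (m : ℝ) ^ 2 - (-t + ((n : ℝ) - m) ^ 2) with hX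
  have h := hIntB ((m : ℝ) ^ 2) (-t + ((n : ℝ) - m) ^ 2)
  have hV : 0 ≤ 2 * (jb (m : ℝ) ^ (-(1/2) : ℝ) + jb k ^ (-(1/2) : ℝ)) := by positivity
  calc _ ≤ ∫⁻ τ : ℝ, ENNReal.ofReal (2 * (jb (m : ℝ) ^ (-(1/2) : ℝ) + jb k ^ (-(1/2) : ℝ))) *
        ENNReal.ofReal (jb (τ + (m : ℝ) ^ 2) ^ (-(3/4) : ℝ) *
          jb (τ + (-t + ((n : ℝ) - m) ^ 2)) ^ (-1 : ℝ)) := by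
        refine lintegral_mono fun τ => ?_
        have p1 := jb_pos (τ + (m : ℝ) ^ 2)
        have p2 := jb_pos (t - τ - ((n : ℝ) - m) ^ 2)
        have e2 : jb (τ + (-t + ((n : ℝ) - m) ^ 2)) = jb (t - τ - ((n : ℝ) - m) ^ 2) := by
          rw [← jb_neg]; ring_nf
        unfold kerA
        simp only [hn, if_false]
        rw [← hk, e2, ← ENNReal.ofReal_mul hV,
          ENNReal.ofReal_rpow_of_nonneg (by positivity) (by norm_num),
          Real.mul_rpow (by positivity) (by positivity),
          Real.mul_rpow (by positivity) (by positivity), sq_pow _ _ (-1) (by norm_num),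
          sq_pow _ _ (-1) (by norm_num)]
        refine ENNReal.ofReal_le_ofReal ?_
        rw [mul_assoc]
        gcongr
        · have a1 := sq_pow (m : ℝ) (-(1/4)) (-(1/2)) (by norm_num)
          have a2 := sq_pow k (-(1/4)) (-(1/2)) (by norm_num)
          rw [Real.rpow_two] at a1 a2
          rw [Real.rpow_two, ← a1, ← a2]
          exact add_sq_le
        · exact jb_one_le _
        · norm_num
    _ ≤ ENNReal.ofReal (2 * (jb (m : ℝ) ^ (-(1/2) : ℝ) + jb k ^ (-(1/2) : ℝ))) *
          (I * ENNReal.ofReal (jb X ^ (-(5/8) : ℝ))) := by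
        rw [lintegral_const_mul _ (by fun_prop)]
        gcongr
    _ = ENNReal.ofReal 2 * I * (ENNReal.ofReal (jb (m : ℝ) ^ (-(1/2) : ℝ) * jb X ^ (-(5/8) : ℝ) +
          jb k ^ (-(1/2) : ℝ) * jb X ^ (-(5/8) : ℝ))) := by
        rw [← add_mul, ENNReal.ofReal_mul two_pos.le, ENNReal.ofReal_mul (by positivity)]
        ring
    _ ≤ _ := by
        have q1 := jb_pos ((m : ℝ) - 0)
        have q2 := jb_pos ((m : ℝ) - y₁)
        have q3 := jb_pos ((m : ℝ) - y₂)
        rw [← ENNReal.ofReal_add (by positivity) (by positivity),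
          ← ENNReal.ofReal_add (by positivity) (by positivity),
          ← ENNReal.ofReal_add (by positivity) (by positivity)]
        have hkk : jb k ^ (-(9/8) : ℝ) ≤ jb ((m : ℝ) - y₁) ^ (-(9/8) : ℝ) := by
          apply jb_anti
          have : k = -2 * (m - y₁) := by rw [hk, hy₁]; ring
          rw [this, abs_mul]
          norm_num
          linarith [abs_nonneg ((m : ℝ) - y₁)]
        have hXX : jb X ^ (-(9/8) : ℝ) ≤ jb ((m : ℝ) - y₂) ^ (-(9/8) : ℝ) := by
          apply jb_anti
          have : X = (2 * n) * (m - y₂) := by rw [hX, hy₂]; field_simp; ring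
          rw [this, abs_mul, abs_mul, abs_two]
          nlinarith [abs_nonneg ((m : ℝ) - y₂)]
        gcongr
        · refine (young_pt _ _).trans ?_
          rw [sub_zero]
          gcongr
        · refine (young_pt _ _).trans ?_
          gcongr

lemma nrm_eq (f : ℝ × ℤ → ℝ) (hf : Measurable f) :
    nrm (fun x => ENNReal.ofReal (f x)) = l2RZ f := by
  unfold nrm l2RZ
  rw [lintegral_muE _ (by fun_prop)]
  simp_rw [ENNReal.rpow_two]

theorem periodic_bilinear_estimate_Y (γ s : ℝ) (hγ : γ ≠ 0) (hγ1 : |γ| ≠ 1)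
    (hs : 1/2 ≤ s) :
    ∃ C : ℝ, 0 < C ∧ ∀ f g h : ℝ × ℤ → ℝ,
      Measurable f → Measurable g → Measurable h →
      (∀ p, 0 ≤ f p) → (∀ p, 0 ≤ g p) → (∀ p, 0 ≤ h p) →
      l2RZ f ≠ ⊤ → l2RZ g ≠ ⊤ → l2RZ h ≠ ⊤ →
      (∑' n : ℤ, ∑' n₁ : ℤ, ∫⁻ τ : ℝ, ∫⁻ τ₁ : ℝ,
        ENNReal.ofReal (
          |(n : ℝ)| * jb (n : ℝ) ^ (s - 1/2) * h (τ, n) * f (τ₁, n₁) * g (τ - τ₁, n - n₁) /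
          (jb (τ + γ * |(n : ℝ)| * (n : ℝ)) ^ (3/8 : ℝ) * jb (n₁ : ℝ) ^ s
            * jb (τ₁ + (n₁ : ℝ) ^ 2) ^ (1/2 : ℝ)
            * jb ((n : ℝ) - (n₁ : ℝ)) ^ s
            * jb (τ - τ₁ - ((n : ℝ) - (n₁ : ℝ)) ^ 2) ^ (1/2 : ℝ))))
      ≤ ENNReal.ofReal C * l2RZ f * l2RZ g * l2RZ h := by
  obtain ⟨C, hC, hpw⟩ := pw_main γ s hγ1 hs
  obtain ⟨CA, hCA, hA⟩ := boundA γ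
  obtain ⟨CB, hCB, hB⟩ := boundB γ hγ1
  obtain ⟨CC, hCC, hCb⟩ := boundC γ hγ1
  set M : ℝ≥0∞ := CA ^ (1/2 : ℝ) + CB ^ (1/2 : ℝ) + CC ^ (1/2 : ℝ) with hM
  have hMt : M ≠ ⊤ := by
    have := fun (x : ℝ≥0∞) (hx : x ≠ ⊤) =>
      ENNReal.rpow_ne_top_of_nonneg (by norm_num : (0:ℝ) ≤ 1/2) hx
    rw [hM]
    exact ENNReal.add_ne_top.2 ⟨ENNReal.add_ne_top.2 ⟨this _ hCA, this _ hCB⟩, this _ hCC⟩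
  refine ⟨C * (M.toReal + 1), by positivity, ?_⟩
  intro f g h hf hg hh hf0 hg0 hh0 _ _ _
  have hMle : M ≤ ENNReal.ofReal (M.toReal + 1) := by
    refine (ENNReal.ofReal_toReal hMt).symm.le.trans (ENNReal.ofReal_le_ofReal (by linarith))
  have mA := meas_kerA γ
  have mB := meas_kerB γ
  have mC := meas_kerC γ
  set F : ℝ × ℤ → ℝ≥0∞ := fun x => ENNReal.ofReal (f x) with hF
  set G : ℝ × ℤ → ℝ≥0∞ := fun x => ENNReal.ofReal (g x) with hG
  set H : ℝ × ℤ → ℝ≥0∞ := fun x => ENNReal.ofReal (h x) with hH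
  have mF : Measurable F := by fun_prop
  have mG : Measurable G := by fun_prop
  have mH : Measurable H := by fun_prop
  set Φ : (ℝ × ℤ) × (ℝ × ℤ) → ℝ≥0∞ := fun p =>
    ENNReal.ofReal C * (H p.1 * F p.2 * G (p.1 - p.2) * kerA γ p +
      H p.1 * F p.2 * G (p.1 - p.2) * kerB γ p + H p.1 * F p.2 * G (p.1 - p.2) * kerC γ p) with hΦ
  have mΦ : Measurable Φ := by fun_prop
  have pt : ∀ (n n₁ : ℤ) (τ τ₁ : ℝ), ENNReal.ofReal (
          |(n : ℝ)| * jb (n : ℝ) ^ (s - 1/2) * h (τ, n) * f (τ₁, n₁) * g (τ - τ₁, n - n₁) /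
          (jb (τ + γ * |(n : ℝ)| * (n : ℝ)) ^ (3/8 : ℝ) * jb (n₁ : ℝ) ^ s
            * jb (τ₁ + (n₁ : ℝ) ^ 2) ^ (1/2 : ℝ)
            * jb ((n : ℝ) - (n₁ : ℝ)) ^ s
            * jb (τ - τ₁ - ((n : ℝ) - (n₁ : ℝ)) ^ 2) ^ (1/2 : ℝ))) ≤ Φ ((τ, n), (τ₁, n₁)) := by
    intro n n₁ τ τ₁
    by_cases hn : n = 0
    · simp [hn]
    have hn1 : 1 ≤ |(n : ℝ)| := by exact_mod_cast Int.one_le_abs hn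
    have hp := hpw (τ + γ * |(n : ℝ)| * (n : ℝ)) (τ₁ + (n₁ : ℝ) ^ 2)
      (τ - τ₁ - ((n : ℝ) - (n₁ : ℝ)) ^ 2) n n₁ hn1 (by ring)
    have i1 := jb_pos (τ + γ * |(n : ℝ)| * (n : ℝ))
    have i2 := jb_pos (τ₁ + (n₁ : ℝ) ^ 2)
    have i3 := jb_pos (τ - τ₁ - ((n : ℝ) - (n₁ : ℝ)) ^ 2)
    have i4 := jb_pos (n₁ : ℝ)
    have i5 := jb_pos (γ * |(n : ℝ)| + n - 2 * n₁)
    have j1 := hh0 (τ, n)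
    have j2 := hf0 (τ₁, n₁)
    have j3 := hg0 (τ - τ₁, n - n₁)
    have hq := mul_le_mul_of_nonneg_left hp (mul_nonneg (mul_nonneg j1 j2) j3)
    have e : |(n : ℝ)| * jb (n : ℝ) ^ (s - 1/2) * h (τ, n) * f (τ₁, n₁) * g (τ - τ₁, n - n₁) /
          (jb (τ + γ * |(n : ℝ)| * (n : ℝ)) ^ (3/8 : ℝ) * jb (n₁ : ℝ) ^ s
            * jb (τ₁ + (n₁ : ℝ) ^ 2) ^ (1/2 : ℝ)
            * jb ((n : ℝ) - (n₁ : ℝ)) ^ s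
            * jb (τ - τ₁ - ((n : ℝ) - (n₁ : ℝ)) ^ 2) ^ (1/2 : ℝ)) =
        h (τ, n) * f (τ₁, n₁) * g (τ - τ₁, n - n₁) * (|(n : ℝ)| * jb (n : ℝ) ^ (s - 1/2) /
          (jb (τ + γ * |(n : ℝ)| * (n : ℝ)) ^ (3/8 : ℝ) * jb (n₁ : ℝ) ^ s
            * jb (τ₁ + (n₁ : ℝ) ^ 2) ^ (1/2 : ℝ)
            * jb ((n : ℝ) - (n₁ : ℝ)) ^ s
            * jb (τ - τ₁ - ((n : ℝ) - (n₁ : ℝ)) ^ 2) ^ (1/2 : ℝ))) := by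
      rw [← mul_div_assoc]; congr 1; ring
    rw [e]
    refine (ENNReal.ofReal_le_ofReal hq).trans (le_of_eq ?_)
    simp only [hΦ, hF, hG, hH, kerA, kerB, kerC, hn, if_false, Prod.mk_sub_mk]
    rw [ENNReal.ofReal_mul (mul_nonneg (mul_nonneg j1 j2) j3), ENNReal.ofReal_mul (mul_nonneg j1 j2),
      ENNReal.ofReal_mul j1, ENNReal.ofReal_mul hC.le,
      ENNReal.ofReal_add (by positivity) (by positivity),
      ENNReal.ofReal_add (by positivity) (by positivity)]
    ring
  have hTA := formA F G H mF mG mH (kerA γ) mA CA hA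
  have hTB := formB F G H mF mG mH (kerB γ) mB CB hB
  have hTC := formC F G H mF mG mH (kerC γ) mC CC hCb
  calc _ ≤ ∑' n : ℤ, ∑' n₁ : ℤ, ∫⁻ τ : ℝ, ∫⁻ τ₁ : ℝ, Φ ((τ, n), (τ₁, n₁)) := by
        refine ENNReal.tsum_le_tsum fun n => ENNReal.tsum_le_tsum fun n₁ => ?_
        exact lintegral_mono fun τ => lintegral_mono fun τ₁ => pt n n₁ τ τ₁
    _ = ∫⁻ x, ∫⁻ y, Φ (x, y) ∂muE ∂muE := by
        rw [lintegral_muE _ mΦ.lintegral_prod_right']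
        refine tsum_congr fun n => ?_
        rw [← lintegral_tsum]
        · refine lintegral_congr fun τ => ?_
          rw [lintegral_muE _ (by fun_prop)]
        · intro n₁
          have : Measurable (fun q : ℝ × ℝ => Φ ((q.1, n), (q.2, n₁))) := by fun_prop
          exact this.lintegral_prod_right'.aemeasurable
    _ = ENNReal.ofReal C * (∫⁻ x, ∫⁻ y, H x * F y * G (x - y) * kerA γ (x, y) ∂muE ∂muE +
          ∫⁻ x, ∫⁻ y, H x * F y * G (x - y) * kerB γ (x, y) ∂muE ∂muE +
          ∫⁻ x, ∫⁻ y, H x * F y * G (x - y) * kerC γ (x, y) ∂muE ∂muE) := by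
        have q : ∀ K : (ℝ × ℤ) × (ℝ × ℤ) → ℝ≥0∞, Measurable K →
            Measurable (fun x => ∫⁻ y, H x * F y * G (x - y) * K (x, y) ∂muE) := by
          intro K hK
          have : Measurable (fun p : (ℝ × ℤ) × (ℝ × ℤ) => H p.1 * F p.2 * G (p.1 - p.2) * K p) := by
            fun_prop
          exact this.lintegral_prod_right'
        have qA := q _ mA
        have qB := q _ mB
        have qC := q _ mC
        rw [← lintegral_add_left qA, ← lintegral_add_right _ qC,
          ← lintegral_const_mul _ (by fun_prop)]
        refine lintegral_congr fun x => ?_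
        rw [← lintegral_add_left (by fun_prop), ← lintegral_add_left (by fun_prop),
          ← lintegral_const_mul _ (by fun_prop)]
    _ ≤ ENNReal.ofReal C * (CA ^ (1/2 : ℝ) * (nrm F * nrm G * nrm H) +
          CB ^ (1/2 : ℝ) * (nrm F * nrm G * nrm H) + CC ^ (1/2 : ℝ) * (nrm F * nrm G * nrm H)) := by
        gcongr
    _ = ENNReal.ofReal C * M * (nrm F * nrm G * nrm H) := by rw [hM]; ring
    _ ≤ ENNReal.ofReal C * ENNReal.ofReal (M.toReal + 1) * (nrm F * nrm G * nrm H) := by gcongr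
    _ = _ := by
        rw [ENNReal.ofReal_mul hC.le, hF, hG, hH, nrm_eq f hf, nrm_eq g hg, nrm_eq h hh]
        ring
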